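/- arXiv:2603.04704 — 2 statements merged into one kernel-verified Lean document; each statement's English description precedes it below -/
import Mathlib

section
/- Let r and t be integers with t ≥ r ≥ 3. For every finite complete r-partite r-uniform hypergraph H (with all r parts nonempty) and every spanning edge-coloring of H with r+t colors, the vertex set of H can be covered by at most t+1 monochromatic connected components. -/
/-- An edge of the complete r-partite r-uniform hypergraph with part assignment `p`
is a transversal: a choice of one vertex from each part. -/
def IsTransversal {V : Type*} {r : ℕ} (p : V → Fin r) (e : Fin r → V) : Prop :=
  ∀ i, p (e i) = i

/-- `u` and `v` lie in the same monochromatic component of color `c`: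
they are joined by a (possibly empty) sequence of edges of color `c`
in which consecutive edges intersect. -/
def SameComp {V : Type*} {r k : ℕ} (p : V → Fin r) (χ : (Fin r → V) → Fin k)
    (c : Fin k) (u v : V) : Prop :=
  Relation.ReflTransGen
    (fun a b => ∃ e, IsTransversal p e ∧ χ e = c ∧ (∃ i, e i = a) ∧ (∃ j, e j = b)) u v

/-- The coloring is spanning: every vertex is contained in an edge of every color. -/
def SpanningColoring {V : Type*} {r k : ℕ} (p : V → Fin r)
    (χ : (Fin r → V) → Fin k) : Prop :=
  ∀ (v : V) (c : Fin k), ∃ e, IsTransversal p e ∧ χ e = c ∧ ∃ i, e i = v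

/-- The vertex set can be covered by at most `m` monochromatic components;
a component is recorded as a pair (color, representative vertex). -/
def CoveredByComponents {V : Type*} {r k : ℕ} (p : V → Fin r)
    (χ : (Fin r → V) → Fin k) (m : ℕ) : Prop :=
  ∃ S : Finset (Fin k × V), S.card ≤ m ∧
    ∀ u : V, ∃ q ∈ S, SameComp p χ q.1 u q.2

lemma grid_aux {V W : Type*} (P1 P2 P3 : V → Prop) (g h : V → W)
    (hg1 : ∀ a b c d, ∃ v, P1 v ∧ g v ≠ a ∧ g v ≠ b ∧ g v ≠ c ∧ g v ≠ d)
    (hh3 : ∀ a b c d, ∃ v, P3 v ∧ h v ≠ a ∧ h v ≠ b ∧ h v ≠ c ∧ h v ≠ d)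
    (y y' z : V) (hy : P2 y) (hy' : P2 y')
    (hz : P3 z) (g1 : g y ≠ g z) (h1 : h y ≠ h z) (g2 : g y' ≠ g z) (h2 : h y' ≠ h z)
    (g3 : g y ≠ g y') (h3 : h y ≠ h y') :
    ∃ x y z, P1 x ∧ P2 y ∧ P3 z ∧ g x ≠ g y ∧ g x ≠ g z ∧ g y ≠ g z ∧
      h x ≠ h y ∧ h x ≠ h z ∧ h y ≠ h z := by
  by_contra hcon
  have key : ∀ x y z, P1 x → P2 y → P3 z → g x ≠ g y → g x ≠ g z → g y ≠ g z →
      h x ≠ h y → h x ≠ h z → h y ≠ h z → False := fun x y z a b c d e f i j k =>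
    hcon ⟨x, y, z, a, b, c, d, e, f, i, j, k⟩
  obtain ⟨x, px, x1, x2, x3, -⟩ := hg1 (g y) (g y') (g z) (g z)
  have hx : h x = h z := by
    have A := key x y z px hy hz x1 x3 g1
    have B := key x y' z px hy' hz x2 x3 g2
    by_contra hne
    have A' : h x = h y := by by_contra h4; exact A h4 hne h1
    have B' : h x = h y' := by by_contra h4; exact B h4 hne h2
    exact h3 (A'.symm.trans B')
  obtain ⟨w, pw, w1, w2, w3, w4⟩ := hg1 (g y) (g y') (g z) (g x)
  have hw : h w = h z := by
    have A := key w y z pw hy hz w1 w3 g1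
    have B := key w y' z pw hy' hz w2 w3 g2
    by_contra hne
    have A' : h w = h y := by by_contra h4; exact A h4 hne h1
    have B' : h w = h y' := by by_contra h4; exact B h4 hne h2
    exact h3 (A'.symm.trans B')
  obtain ⟨u, pu, u1, u2, u3, -⟩ := hh3 (h z) (h y) (h y') (h z)
  have aux : ∀ x, P1 x → g x ≠ g y → g x ≠ g y' → h x = h z → g u = g x := by
    intro x px x1 x2 hx
    by_contra hne
    have A : g y = g u := by
      by_contra h4
      exact key x y u px hy pu x1 (Ne.symm hne) h4 (hx ▸ h1.symm) (hx ▸ u1.symm) u2.symm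
    have B : g y' = g u := by
      by_contra h4
      exact key x y' u px hy' pu x2 (Ne.symm hne) h4 (hx ▸ h2.symm) (hx ▸ u1.symm) u3.symm
    exact g3 (A.trans B.symm)
  exact w4 ((aux w pw w1 w2 hw).symm.trans (aux x px x1 x2 hx))

lemma grid_main {V W : Type*} (P1 P2 P3 : V → Prop) (g h : V → W)
    (hg1 : ∀ a b c d, ∃ v, P1 v ∧ g v ≠ a ∧ g v ≠ b ∧ g v ≠ c ∧ g v ≠ d)
    (hg2 : ∀ a b c d, ∃ v, P2 v ∧ g v ≠ a ∧ g v ≠ b ∧ g v ≠ c ∧ g v ≠ d)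
    (hg3 : ∀ a b c d, ∃ v, P3 v ∧ g v ≠ a ∧ g v ≠ b ∧ g v ≠ c ∧ g v ≠ d)
    (hh2 : ∀ a b c d, ∃ v, P2 v ∧ h v ≠ a ∧ h v ≠ b ∧ h v ≠ c ∧ h v ≠ d)
    (hh3 : ∀ a b c d, ∃ v, P3 v ∧ h v ≠ a ∧ h v ≠ b ∧ h v ≠ c ∧ h v ≠ d)
    (hP : ∀ v, P1 v ∨ P2 v ∨ P3 v) (v0 : V)
    (hc : ∀ y z, ∃ v, g v ≠ g y ∧ g v ≠ g z ∧ h v ≠ h y ∧ h v ≠ h z) :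
    ∃ x y z, P1 x ∧ P2 y ∧ P3 z ∧ g x ≠ g y ∧ g x ≠ g z ∧ g y ≠ g z ∧
      h x ≠ h y ∧ h x ≠ h z ∧ h y ≠ h z := by
  have hdis : ∃ y z, P2 y ∧ P3 z ∧ g y ≠ g z ∧ h y ≠ h z := by
    by_contra hcon
    have key : ∀ y z, P2 y → P3 z → g y ≠ g z → h y = h z := by
      intro y z a b c
      by_contra d
      exact hcon ⟨y, z, a, b, c, d⟩
    obtain ⟨y, py, -⟩ := hg2 (g v0) (g v0) (g v0) (g v0)
    obtain ⟨z, pz, z1, -⟩ := hg3 (g y) (g y) (g y) (g y)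
    obtain ⟨w, pw, w1, -⟩ := hh3 (h y) (h y) (h y) (h y)
    obtain ⟨u, pu, u1, u2, -⟩ := hg2 (g y) (g z) (g y) (g y)
    have e1 := key y z py pz z1.symm
    have e2 := key u z pu pz u2
    have e3 : g y = g w := by
      by_contra h4
      exact w1 (key y w py pw h4).symm
    have e4 := key u w pu pw (e3 ▸ u1)
    exact w1 (by rw [← e4, e2, e1])
  obtain ⟨y, z, py, pz, g1, h1⟩ := hdis
  obtain ⟨v, v1, v2, v3, v4⟩ := hc y z
  rcases hP v with pv | pv | pv
  · exact ⟨v, y, z, pv, py, pz, v1, v2, g1, v3, v4, h1⟩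
  · exact grid_aux P1 P2 P3 g h hg1 hh3 y v z py pv pz g1 h1 v2 v4 v1.symm v3.symm
  · obtain ⟨a, b, c, pa, pb, pc, q1, q2, q3, q4, q5, q6⟩ :=
      grid_aux P1 P3 P2 g h hg1 hh2 z v y pz pv py g1.symm h1.symm v1 v3 v2.symm v4.symm
    exact ⟨a, c, b, pa, pc, pb, q2, q1, q3.symm, q5, q4, q6.symm⟩

lemma SameComp.symm' {V : Type*} {r k : ℕ} {p : V → Fin r} {χ : (Fin r → V) → Fin k}
    {c : Fin k} {u v : V} (h : SameComp p χ c u v) : SameComp p χ c v u := by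
  unfold SameComp at *
  induction h with
  | refl => exact Relation.ReflTransGen.refl
  | tail _ hbc ih =>
    obtain ⟨e, h1, h2, h3, h4⟩ := hbc
    exact Relation.ReflTransGen.head ⟨e, h1, h2, h4, h3⟩ ih

lemma SameComp.trans' {V : Type*} {r k : ℕ} {p : V → Fin r} {χ : (Fin r → V) → Fin k}
    {c : Fin k} {u v w : V} (h : SameComp p χ c u v) (h' : SameComp p χ c v w) :
    SameComp p χ c u w := Relation.ReflTransGen.trans h h'

lemma sameComp_edge {V : Type*} {r k : ℕ} {p : V → Fin r} {χ : (Fin r → V) → Fin k}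
    {e : Fin r → V} (he : IsTransversal p e) (i j : Fin r) :
    SameComp p χ (χ e) (e i) (e j) :=
  Relation.ReflTransGen.single ⟨e, he, rfl, ⟨i, rfl⟩, ⟨j, rfl⟩⟩

/-- For t ≥ r ≥ 3, any spanning (r+t)-coloring of a complete r-partite r-uniform
hypergraph admits a cover of the vertex set by at most t+1 monochromatic components. -/
theorem cov_upper_bound (r t : ℕ) (hr : 3 ≤ r) (hrt : r ≤ t)
    (V : Type*) [Fintype V] (p : V → Fin r) (hp : Function.Surjective p)
    (χ : (Fin r → V) → Fin (r + t))
    (hspan : SpanningColoring p χ) :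
    CoveredByComponents p χ (t + 1) := by
  classical
  by_contra hcov
  have hno : ∀ S : Finset (Fin (r + t) × V), S.card ≤ t + 1 →
      ∃ u, ∀ q ∈ S, ¬ SameComp p χ q.1 u q.2 := by
    intro S hS
    by_contra h
    push Not at h
    exact hcov ⟨S, hS, h⟩
  have hno4 : ∀ a b c d : Fin (r + t) × V, ∃ u, ¬ SameComp p χ a.1 u a.2 ∧
      ¬ SameComp p χ b.1 u b.2 ∧ ¬ SameComp p χ c.1 u c.2 ∧ ¬ SameComp p χ d.1 u d.2 := by
    intro a b c d
    obtain ⟨u, hu⟩ := hno {a, b, c, d} (Finset.card_le_four.trans (by omega))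
    exact ⟨u, hu a (by simp), hu b (by simp), hu c (by simp), hu d (by simp)⟩
  -- move into a given part
  have hmove : ∀ (c : Fin (r + t)) (u : V) (j : Fin r), ∃ v, p v = j ∧ SameComp p χ c u v := by
    intro c u j
    obtain ⟨e, he, hc, i, hi⟩ := hspan u c
    refine ⟨e j, he j, ?_⟩
    rw [← hi, ← hc]
    exact sameComp_edge he i j
  have hmiss : ∀ (c : Fin (r + t)) (x : V) (j : Fin r), ∃ v, p v = j ∧ ¬ SameComp p χ c x v := by
    intro c x j
    obtain ⟨u, hu, -⟩ := hno4 (c, x) (c, x) (c, x) (c, x)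
    obtain ⟨v, hv, hv'⟩ := hmove c u j
    exact ⟨v, hv, fun h => hu (hv'.trans' h.symm')⟩
  choose miss miss1 miss2 using hmiss
  -- the triple lemma
  have htri : ∀ x y z, (p x).1 = 0 → (p y).1 = 1 → 2 ≤ (p z).1 →
      ∃ c : Fin (r + t), (c.1 < 3 ∨ r ≤ c.1) ∧ SameComp p χ c x y ∧ SameComp p χ c x z := by
    intro x y z hx hy hz
    let δ : Fin r → Fin (r + t) := fun j => if j.1 = 2 then ⟨(p z).1, by omega⟩ else ⟨j.1, by omega⟩
    let e : Fin r → V := fun j => if j = p x then x else if j = p y then y else if j = p z then z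
      else miss (δ j) x j
    have he : IsTransversal p e := by
      intro j
      simp only [e]
      split_ifs with h1 h2 h3
      · exact h1.symm
      · exact h2.symm
      · exact h3.symm
      · exact miss1 _ _ _
    have ex : e (p x) = x := by simp [e]
    have hyx : p y ≠ p x := by intro h; rw [h] at hy; omega
    have hzx : p z ≠ p x := by intro h; rw [h] at hz; omega
    have hzy : p z ≠ p y := by intro h; rw [h] at hz; omega
    have ey : e (p y) = y := by simp [e, hyx]
    have ez : e (p z) = z := by simp [e, hzx, hzy]
    refine ⟨χ e, ?_, ?_, ?_⟩
    · by_contra hlt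
      push Not at hlt
      obtain ⟨l1, l2⟩ := hlt
      have hj : ∃ j : Fin r, j ≠ p x ∧ j ≠ p y ∧ j ≠ p z ∧ δ j = χ e := by
        by_cases hc : (χ e).1 = (p z).1
        · refine ⟨⟨2, by omega⟩, ?_, ?_, ?_, ?_⟩
          · intro h; have := congrArg Fin.val h; simp only at this; omega
          · intro h; have := congrArg Fin.val h; simp only at this; omega
          · intro h; have := congrArg Fin.val h; simp only at this; omega
          · apply Fin.ext; simp [δ, hc]
        · refine ⟨⟨(χ e).1, l2⟩, ?_, ?_, ?_, ?_⟩
          · intro h; have := congrArg Fin.val h; simp only at this; omega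
          · intro h; have := congrArg Fin.val h; simp only at this; omega
          · intro h; have := congrArg Fin.val h; simp only at this; omega
          · have : (χ e).1 ≠ 2 := by omega
            apply Fin.ext; simp [δ, this]
      obtain ⟨j, j1, j2, j3, j4⟩ := hj
      have ej : e j = miss (χ e) x j := by
        rw [← j4]; simp [e, j1, j2, j3]
      have := sameComp_edge (χ := χ) he (p x) j
      rw [ex, ej] at this
      exact miss2 _ _ _ this
    · have := sameComp_edge (χ := χ) he (p x) (p y)
      rwa [ex, ey] at this
    · have := sameComp_edge (χ := χ) he (p x) (p z)
      rwa [ex, ez] at this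
  -- labels
  let f : Fin (r + t) → V → Set V := fun c v => {u | SameComp p χ c u v}
  have hf : ∀ c u v, f c u = f c v ↔ SameComp p χ c u v := by
    intro c u v
    constructor
    · intro h
      have : u ∈ f c u := Relation.ReflTransGen.refl
      rw [h] at this
      exact this
    · intro h
      ext w
      exact ⟨fun hw => SameComp.trans' hw h, fun hw => SameComp.trans' hw h.symm'⟩
  obtain ⟨v0, -⟩ := hp ⟨0, by omega⟩
  have hrow : ∀ (c : Fin (r + t)) (j : Fin r) (A B C D : Set V),
      ∃ v, p v = j ∧ f c v ≠ A ∧ f c v ≠ B ∧ f c v ≠ C ∧ f c v ≠ D := by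
    intro c j A B C D
    have hrep : ∀ A : Set V, ∃ a : V, ∀ v, f c v = A → SameComp p χ c v a := by
      intro A
      by_cases h : ∃ a, f c a = A
      · obtain ⟨a, ha⟩ := h
        exact ⟨a, fun v hv => (hf c v a).1 (hv.trans ha.symm)⟩
      · exact ⟨v0, fun v hv => (h ⟨v, hv⟩).elim⟩
    obtain ⟨a, ha⟩ := hrep A
    obtain ⟨b, hb⟩ := hrep B
    obtain ⟨c', hc'⟩ := hrep C
    obtain ⟨d, hd⟩ := hrep D
    obtain ⟨u, u1, u2, u3, u4⟩ := hno4 (c, a) (c, b) (c, c') (c, d)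
    obtain ⟨v, hv, huv⟩ := hmove c u j
    exact ⟨v, hv, fun h => u1 (huv.trans' (ha v h)), fun h => u2 (huv.trans' (hb v h)),
      fun h => u3 (huv.trans' (hc' v h)), fun h => u4 (huv.trans' (hd v h))⟩
  let c0 : Fin (r + t) := ⟨0, by omega⟩
  let c1 : Fin (r + t) := ⟨1, by omega⟩
  have hrow1 : ∀ (c : Fin (r + t)) (A B C D : Set V),
      ∃ v, (p v).1 = 0 ∧ f c v ≠ A ∧ f c v ≠ B ∧ f c v ≠ C ∧ f c v ≠ D := by
    intro c A B C D
    obtain ⟨v, h1, h2⟩ := hrow c ⟨0, by omega⟩ A B C D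
    exact ⟨v, by rw [h1], h2⟩
  have hrow2 : ∀ (c : Fin (r + t)) (A B C D : Set V),
      ∃ v, (p v).1 = 1 ∧ f c v ≠ A ∧ f c v ≠ B ∧ f c v ≠ C ∧ f c v ≠ D := by
    intro c A B C D
    obtain ⟨v, h1, h2⟩ := hrow c ⟨1, by omega⟩ A B C D
    exact ⟨v, by rw [h1], h2⟩
  have hrow3 : ∀ (c : Fin (r + t)) (A B C D : Set V),
      ∃ v, 2 ≤ (p v).1 ∧ f c v ≠ A ∧ f c v ≠ B ∧ f c v ≠ C ∧ f c v ≠ D := by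
    intro c A B C D
    obtain ⟨v, h1, h2⟩ := hrow c ⟨2, by omega⟩ A B C D
    exact ⟨v, by rw [h1], h2⟩
  obtain ⟨x, y, z, px, py, pz, q1, q2, q3, q4, q5, q6⟩ :=
    grid_main (fun v => (p v).1 = 0) (fun v => (p v).1 = 1) (fun v => 2 ≤ (p v).1)
      (f c0) (f c1) (hrow1 c0) (hrow2 c0) (hrow3 c0) (hrow2 c1) (hrow3 c1)
      (fun v => by omega) v0 (by
        intro y z
        obtain ⟨u, u1, u2, u3, u4⟩ := hno4 (c0, y) (c0, z) (c1, y) (c1, z)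
        exact ⟨u, fun h => u1 ((hf _ _ _).1 h), fun h => u2 ((hf _ _ _).1 h),
          fun h => u3 ((hf _ _ _).1 h), fun h => u4 ((hf _ _ _).1 h)⟩)
  simp only [ne_eq, hf] at q1 q2 q3 q4 q5 q6
  let col : Fin (t + 1) → Fin (r + t) := fun i =>
    if i.1 = 0 then ⟨2, by omega⟩ else ⟨r + i.1 - 1, by omega⟩
  let maj : Fin (r + t) → V := fun c => if SameComp p χ c x y ∨ SameComp p χ c x z then x else y
  obtain ⟨u, hu⟩ := hno (Finset.univ.image fun i => (col i, maj (col i)))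
    (Finset.card_image_le.trans (by simp))
  have hu' : ∀ c : Fin (r + t), (c.1 < 3 ∨ r ≤ c.1) → c ≠ c0 → c ≠ c1 →
      ¬ SameComp p χ c u (maj c) := by
    intro c hc n0 n1
    have m0 : c.1 ≠ 0 := fun h => n0 (Fin.ext h)
    have m1 : c.1 ≠ 1 := fun h => n1 (Fin.ext h)
    have : ∃ i, col i = c := by
      by_cases h2 : c.1 = 2
      · exact ⟨⟨0, by omega⟩, Fin.ext (by simp [col, h2])⟩
      · have h5 : c.1 - r + 1 ≠ 0 := by omega
        refine ⟨⟨c.1 - r + 1, by omega⟩, Fin.ext ?_⟩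
        simp only [col, h5, if_false]
        omega
    obtain ⟨i, rfl⟩ := this
    exact hu (col i, maj (col i)) (Finset.mem_image_of_mem _ (Finset.mem_univ i))
  have hcases : (p u).1 = 0 ∨ (p u).1 = 1 ∨ 2 ≤ (p u).1 := by omega
  rcases hcases with pu | pu | pu
  · obtain ⟨c, hc, k1, k2⟩ := htri u y z pu py pz
    have kyz := k1.symm'.trans' k2
    refine hu' c hc (by rintro rfl; exact q3 kyz) (by rintro rfl; exact q6 kyz) ?_
    simp only [maj]
    split_ifs with h
    · rcases h with h | h
      · exact k1.trans' h.symm'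
      · exact k2.trans' h.symm'
    · exact k1
  · obtain ⟨c, hc, k1, k2⟩ := htri x u z px pu pz
    refine hu' c hc (by rintro rfl; exact q2 k2) (by rintro rfl; exact q5 k2) ?_
    simp only [maj, k2, or_true, if_true]
    exact k1.symm'
  · obtain ⟨c, hc, k1, k2⟩ := htri x y u px py pu
    refine hu' c hc (by rintro rfl; exact q1 k1) (by rintro rfl; exact q4 k1) ?_
    simp only [maj, k1, true_or, if_true]
    exact k2.symm'
end

section
/- For every finite complete bipartite graph G with both parts nonempty and every spanning edge-coloring of G with 3 colors, the vertex set of G can be covered by at most 3 monochromatic connected components. -/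
/-- In a bipartite graph with side-assignment `side` and edge-coloring `χ`,
`u` and `v` lie in the same monochromatic component of color `c`:
they are joined by a (possibly empty) walk of edges of color `c`. -/
def SameCompBip {V K : Type*} (side : V → Bool) (χ : V → V → K)
    (c : K) (u v : V) : Prop :=
  Relation.ReflTransGen (fun a b => side a ≠ side b ∧ χ a b = c) u v

theorem covU {V L M N : Type*} (f : V → L) (g : V → M) (h : V → N)
    (x x1 x2 y3 y4 z3 z4 : V)
    (hf1 : f x ≠ f x1) (hf2 : f x ≠ f x2)
    (hg12 : g x1 ≠ g x2) (hh12 : h x1 ≠ h x2) (hf12 : f x1 ≠ f x2)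
    (gy31 : g y3 ≠ g x1) (gy32 : g y3 ≠ g x2) (gy41 : g y4 ≠ g x1) (gy42 : g y4 ≠ g x2)
    (gy : g y3 ≠ g y4)
    (hz31 : h z3 ≠ h x1) (hz32 : h z3 ≠ h x2) (hz41 : h z4 ≠ h x1) (hz42 : h z4 ≠ h x2)
    (hz : h z3 ≠ h z4)
    (I : ∀ a ∈ [x, x1, x2], ∀ b ∈ [y3, y4, z3, z4], f a = f b ∨ g a = g b ∨ h a = h b) :
    h y3 = h x ∧ h y4 = h x ∧ g z3 = g x ∧ g z4 = g x := by
  simp only [List.mem_cons, List.not_mem_nil, or_false, forall_eq_or_imp, forall_eq] at I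
  obtain ⟨⟨a1, a2, a3, a4⟩, ⟨b1, b2, b3, b4⟩, ⟨c1, c2, c3, c4⟩⟩ := I
  have e3 : (f y3 = f x1 ∧ h y3 = h x2) ∨ (f y3 = f x2 ∧ h y3 = h x1) := by grind
  have e4 : (f y4 = f x1 ∧ h y4 = h x2) ∨ (f y4 = f x2 ∧ h y4 = h x1) := by grind
  have d3 : (f z3 = f x1 ∧ g z3 = g x2) ∨ (f z3 = f x2 ∧ g z3 = g x1) := by grind
  have d4 : (f z4 = f x1 ∧ g z4 = g x2) ∨ (f z4 = f x2 ∧ g z4 = g x1) := by grind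
  have p1 : g x = g y3 ∨ h x = h y3 := by grind
  have p2 : g x = g y4 ∨ h x = h y4 := by grind
  have p3 : g x = g z3 ∨ h x = h z3 := by grind
  have p4 : g x = g z4 ∨ h x = h z4 := by grind
  have q1 : h x = h x1 ∨ h x = h x2 := by grind
  have q2 : g x = g x1 ∨ g x = g x2 := by grind
  grind

theorem covP {V L M N : Type*} (s : V → Bool) (f : V → L) (g : V → M) (h : V → N)
    (I : ∀ u v, s u ≠ s v → f u = f v ∨ g u = g v ∨ h u = h v)
    (x3 x4 y3 y4 : V) (sx3 : s x3 = true) (sx4 : s x4 = true)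
    (sy3 : s y3 = false) (sy4 : s y4 = false)
    (f1 : f x4 = f x3) (f2 : f y3 = f x3) (f3 : f y4 = f x3)
    (g1 : g x4 = g x3) (g2 : g y3 = g x3) (g3 : g y4 = g x3)
    (h1 : h x3 ≠ h x4) (h2 : h y3 ≠ h y4) : ∃ v w, ∀ u, f u = f v ∨ g u = g w := by
  refine ⟨x3, x3, fun u => ?_⟩
  cases hu : s u
  · have := I u x3 (by simp [*]); have := I u x4 (by simp [*]); grind
  · have := I u y3 (by simp [*]); have := I u y4 (by simp [*]); grind

theorem covW {V L : Type*} (s : V → Bool) (f : V → L)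
    (hs : ∀ v, ∃ w, s w ≠ s v ∧ f w = f v)
    (hn : ∀ a b c, ∃ u, f u ≠ f a ∧ f u ≠ f b ∧ f u ≠ f c) (a b : V) :
    ∃ x3 x4 y3 y4, s x3 = true ∧ s x4 = true ∧ s y3 = false ∧ s y4 = false ∧
      f x3 ≠ f a ∧ f x3 ≠ f b ∧ f x4 ≠ f a ∧ f x4 ≠ f b ∧ f x3 ≠ f x4 ∧
      f y3 = f x3 ∧ f y4 = f x4 := by
  have key : ∀ v, ∃ p q, s p = true ∧ s q = false ∧ f p = f v ∧ f q = f v := by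
    intro v
    obtain ⟨w, hw, e⟩ := hs v
    cases hv : s v
    · exact ⟨w, v, by simpa [hv] using hw, hv, e, rfl⟩
    · exact ⟨v, w, hv, by simpa [hv] using hw, rfl, e⟩
  obtain ⟨u, u1, u2, -⟩ := hn a b a
  obtain ⟨v, v1, v2, v3⟩ := hn a b u
  obtain ⟨p, q, hp, hq, ep, eq⟩ := key u
  obtain ⟨p', q', hp', hq', ep', eq'⟩ := key v
  refine ⟨p, p', q, q', hp, hp', hq, hq', ?_⟩
  rw [ep, ep', eq, eq']
  exact ⟨u1, u2, v1, v2, v3.symm, rfl, rfl⟩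

theorem covS {V L M N : Type*} (f : V → L) (g : V → M) (h : V → N) (x1 x2 y : V)
    (g1 : g y ≠ g x1) (g2 : g y ≠ g x2) (f12 : f x1 ≠ f x2) (h12 : h x1 ≠ h x2)
    (F1 : f x1 = f y ∨ g x1 = g y ∨ h x1 = h y) (F2 : f x2 = f y ∨ g x2 = g y ∨ h x2 = h y) :
    f y = f x1 ∧ h y = h x2 ∨ f y = f x2 ∧ h y = h x1 := by
  grind

theorem covT {L M N : Type*} (f1 f2 fd fl : L) (g1 g2 gb gl : M) (h1 h2 hb hd : N)
    (f12 : f1 ≠ f2) (g12 : g1 ≠ g2) (h12 : h1 ≠ h2)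
    (W1 : fd = f1 ∧ hd = h2 ∨ fd = f2 ∧ hd = h1)
    (W2 : gb = g1 ∧ hb = h2 ∨ gb = g2 ∧ hb = h1)
    (W3 : fl = f1 ∧ gl = g2 ∨ fl = f2 ∧ gl = g1)
    (F : gl = gb ∨ hd = hb) :
    (gb = gl ∧ hb = hd) ∨ (fd = fl ∧ hd = hb) ∨ (fl = fd ∧ gl = gb) := by
  grind

set_option maxHeartbeats 2000000 in
theorem covCore {V L M N : Type*} (s : V → Bool) (f : V → L) (g : V → M) (h : V → N)
    (I : ∀ u v, s u ≠ s v → f u = f v ∨ g u = g v ∨ h u = h v)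
    (sf : ∀ v, ∃ w, s w ≠ s v ∧ f w = f v)
    (sg : ∀ v, ∃ w, s w ≠ s v ∧ g w = g v)
    (sh : ∀ v, ∃ w, s w ≠ s v ∧ h w = h v)
    (nf : ∀ a b c, ∃ u, f u ≠ f a ∧ f u ≠ f b ∧ f u ≠ f c)
    (ng : ∀ a b c, ∃ u, g u ≠ g a ∧ g u ≠ g b ∧ g u ≠ g c)
    (nh : ∀ a b c, ∃ u, h u ≠ h a ∧ h u ≠ h b ∧ h u ≠ h c)
    (x1 x2 : V) (s1 : s x1 = true) (s2 : s x2 = true)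
    (f12 : f x1 ≠ f x2) (g12 : g x1 ≠ g x2) (h12 : h x1 ≠ h x2) :
    (∃ v w, ∀ u, f u = f v ∨ g u = g w) ∨ (∃ v w, ∀ u, f u = f v ∨ h u = h w) ∨
    (∃ v w, ∀ u, g u = g v ∨ h u = h w) := by
  obtain ⟨a3, a4, b3, b4, sa3, sa4, sb3, sb4, A1, A2, A3, A4, A5, A6, A7⟩ := covW s f sf nf x1 x2
  obtain ⟨c3, c4, d3, d4, sc3, sc4, sd3, sd4, C1, C2, C3, C4, C5, C6, C7⟩ := covW s g sg ng x1 x2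
  obtain ⟨k3, k4, l3, l4, sk3, sk4, sl3, sl4, K1, K2, K3, K4, K5, K6, K7⟩ := covW s h sh nh x1 x2
  have J : ∀ u v, s u = true → s v = false → f u = f v ∨ g u = g v ∨ h u = h v :=
    fun u v p q => I u v (by simp [p, q])
  have U1 : ∀ x, s x = true → f x ≠ f x1 → f x ≠ f x2 →
      h d3 = h x ∧ h d4 = h x ∧ g l3 = g x ∧ g l4 = g x := by
    intro x sx e1 e2
    clear sf sg sh nf ng nh
    apply covU f g h x x1 x2 d3 d4 l3 l4 e1 e2 g12 h12 f12 <;> try (clear J I; grind)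
    simp only [List.mem_cons, List.not_mem_nil, or_false, forall_eq_or_imp, forall_eq]
    refine ⟨⟨?_, ?_, ?_, ?_⟩, ⟨?_, ?_, ?_, ?_⟩, ⟨?_, ?_, ?_, ?_⟩⟩ <;> apply J <;> assumption
  have U2 : ∀ x, s x = true → g x ≠ g x1 → g x ≠ g x2 →
      h b3 = h x ∧ h b4 = h x ∧ f l3 = f x ∧ f l4 = f x := by
    intro x sx e1 e2
    clear sf sg sh nf ng nh
    apply covU g f h x x1 x2 b3 b4 l3 l4 e1 e2 f12 h12 g12 <;> try (clear J I; grind)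
    simp only [List.mem_cons, List.not_mem_nil, or_false, forall_eq_or_imp, forall_eq]
    refine ⟨⟨?_, ?_, ?_, ?_⟩, ⟨?_, ?_, ?_, ?_⟩, ⟨?_, ?_, ?_, ?_⟩⟩ <;> rw [or_left_comm] <;> apply J <;> assumption
  have U3 : ∀ x, s x = true → h x ≠ h x1 → h x ≠ h x2 →
      g b3 = g x ∧ g b4 = g x ∧ f d3 = f x ∧ f d4 = f x := by
    intro x sx e1 e2
    clear sf sg sh nf ng nh
    apply covU h f g x x1 x2 b3 b4 d3 d4 e1 e2 f12 g12 h12 <;> try (clear J I; grind)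
    simp only [List.mem_cons, List.not_mem_nil, or_false, forall_eq_or_imp, forall_eq]
    refine ⟨⟨?_, ?_, ?_, ?_⟩, ⟨?_, ?_, ?_, ?_⟩, ⟨?_, ?_, ?_, ?_⟩⟩ <;> rw [or_comm, or_assoc] <;> apply J <;> assumption
  obtain ⟨p1, p2, p3, p4⟩ := U1 a3 sa3 A1 A2
  obtain ⟨p1', p2', p3', p4'⟩ := U1 a4 sa4 A3 A4
  obtain ⟨q1, q2, q3, q4⟩ := U2 c3 sc3 C1 C2
  obtain ⟨q1', q2', q3', q4'⟩ := U2 c4 sc4 C3 C4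
  obtain ⟨r1, r2, r3, r4⟩ := U3 k3 sk3 K1 K2
  obtain ⟨r1', r2', r3', r4'⟩ := U3 k4 sk4 K3 K4
  have F1 := J a3 b4 sa3 sb4
  have F2 := J x1 d3 s1 sd3
  have F3 := J x2 d3 s2 sd3
  have F4 := J x1 b3 s1 sb3
  have F5 := J x2 b3 s2 sb3
  have F6 := J x1 l3 s1 sl3
  have F7 := J x2 l3 s2 sl3
  have I2 : ∀ u v, s u ≠ s v → g u = g v ∨ h u = h v ∨ f u = f v := fun u v e => or_assoc.1 (or_comm.1 (I u v e))
  have I3 : ∀ u v, s u ≠ s v → f u = f v ∨ h u = h v ∨ g u = g v := fun u v e => (I u v e).imp_right Or.symm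
  have P1 := covP s g h f I2 a3 a4 b3 b4 sa3 sa4 sb3 sb4
  have P2 := covP s f h g I3 c3 c4 d3 d4 sc3 sc4 sd3 sd4
  have P3 := covP s f g h I k3 k4 l3 l4 sk3 sk4 sl3 sl4
  clear U1 U2 U3 J I I2 I3 sf sg sh nf ng nh
  have W1 := covS f g h x1 x2 d3 (C6 ▸ C1) (C6 ▸ C2) f12 h12 F2 F3
  have W2 := covS g f h x1 x2 b3 (A6 ▸ A1) (A6 ▸ A2) g12 h12 (or_left_comm.1 F4) (or_left_comm.1 F5)
  have W3 := covS f h g x1 x2 l3 (K6 ▸ K1) (K6 ▸ K2) f12 g12 (F6.imp_right Or.symm) (F7.imp_right Or.symm)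
  have F : g l3 = g b3 ∨ h d3 = h b3 := by
    rcases F1 with e | e | e
    · exact absurd (e.trans A7) A5
    · left; rw [p3, e, r2, r1]
    · right; rw [p1, e, q2, q1]
  have T : (g b3 = g l3 ∧ h b3 = h d3) ∨ (f d3 = f l3 ∧ h d3 = h b3) ∨
      (f l3 = f d3 ∧ g l3 = g b3) := covT _ _ _ _ _ _ _ _ _ _ _ _ f12 g12 h12 W1 W2 W3 F
  rcases T with ⟨t1, t2⟩ | ⟨t1, t2⟩ | ⟨t1, t2⟩
  · right; right
    exact P1 (p3'.symm.trans p3) (t1.trans p3) (r2.trans (r1.symm.trans (t1.trans p3)))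
      (p1'.symm.trans p1) (t2.trans p1) (q2.trans (q1.symm.trans (t2.trans p1)))
      A5 (by rw [A6, A7]; exact A5)
  · right; left
    exact P2 (q3'.symm.trans q3) (t1.trans q3) (r4.trans (r3.symm.trans (t1.trans q3)))
      (q1'.symm.trans q1) (t2.trans q1) (p2.trans (p1.symm.trans (t2.trans q1)))
      C5 (by rw [C6, C7]; exact C5)
  · left
    exact P3 (r3'.symm.trans r3) (t1.trans r3) (q4.trans (q3.symm.trans (t1.trans r3)))
      (r1'.symm.trans r1) (t2.trans r1) (p4.trans (p3.symm.trans (t2.trans r1)))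
      K5 (by rw [K6, K7]; exact K5)

/-- Every spanning 3-edge-coloring of a complete bipartite graph admits a cover of
its vertex set by at most 3 monochromatic components. -/
theorem cov_three_colors (V : Type*) [Fintype V] (side : V → Bool)
    (hX : ∃ v, side v = true) (hY : ∃ v, side v = false)
    (χ : V → V → Fin 3) (hsym : ∀ u v, χ u v = χ v u)
    (hspan : ∀ (v : V) (c : Fin 3), ∃ w, side w ≠ side v ∧ χ v w = c) :
    ∃ S : Finset (Fin 3 × V), S.card ≤ 3 ∧
      ∀ u : V, ∃ q ∈ S, SameCompBip side χ q.1 u q.2 := by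
  classical
  have mk : ∀ (p q r : Fin 3 × V), (∀ u, SameCompBip side χ p.1 u p.2 ∨
      SameCompBip side χ q.1 u q.2 ∨ SameCompBip side χ r.1 u r.2) →
      ∃ S : Finset (Fin 3 × V), S.card ≤ 3 ∧
      ∀ u : V, ∃ q ∈ S, SameCompBip side χ q.1 u q.2 := by
    intro p q r H
    refine ⟨{p, q, r}, Finset.card_le_three, fun u => ?_⟩
    rcases H u with h | h | h
    · exact ⟨p, by simp, h⟩
    · exact ⟨q, by simp, h⟩
    · exact ⟨r, by simp, h⟩
  let st : Fin 3 → Setoid V := fun c =>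
    { r := SameCompBip side χ c
      iseqv := ⟨fun _ => Relation.ReflTransGen.refl,
        fun h => Relation.ReflTransGen.mono
          (fun a b hab => ⟨hab.1.symm, by rw [hsym]; exact hab.2⟩) _ _ (Relation.ReflTransGen.swap _ _ h),
        fun h k => Relation.ReflTransGen.trans h k⟩ }
  let F : (c : Fin 3) → V → Quotient (st c) := fun c v => Quotient.mk (st c) v
  have FE : ∀ c u v, F c u = F c v ↔ SameCompBip side χ c u v := fun c u v => Quotient.eq (r := st c)
  simp only [← FE] at mk ⊢
  have I : ∀ u v, side u ≠ side v → F 0 u = F 0 v ∨ F 1 u = F 1 v ∨ F 2 u = F 2 v := by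
    intro u v huv
    have : F (χ u v) u = F (χ u v) v := (FE _ _ _).2 (Relation.ReflTransGen.single ⟨huv, rfl⟩)
    generalize χ u v = c at this
    fin_cases c
    · exact Or.inl this
    · exact Or.inr (Or.inl this)
    · exact Or.inr (Or.inr this)
  have S : ∀ c v, ∃ w, side w ≠ side v ∧ F c w = F c v := by
    intro c v
    obtain ⟨w, hw, e⟩ := hspan v c
    exact ⟨w, hw, (FE _ _ _).2 (Relation.ReflTransGen.single ⟨hw, by rw [hsym, e]⟩)⟩
  by_contra hno
  have N : ∀ c, ∀ a b d, ∃ u, F c u ≠ F c a ∧ F c u ≠ F c b ∧ F c u ≠ F c d := by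
    intro c a b d
    by_contra hc
    apply hno
    apply mk (c, a) (c, b) (c, d)
    intro u
    by_contra h
    push Not at h
    exact hc ⟨u, h⟩
  obtain ⟨x1, s1⟩ := hX
  have : ∃ x2, F 0 x1 ≠ F 0 x2 ∧ F 1 x1 ≠ F 1 x2 ∧ F 2 x1 ≠ F 2 x2 := by
    by_contra hc
    apply hno
    apply mk (0, x1) (1, x1) (2, x1)
    intro u
    by_contra h
    push Not at h
    exact hc ⟨u, h.1.symm, h.2.1.symm, h.2.2.symm⟩
  obtain ⟨x2, f12, g12, h12⟩ := this
  have s2 : side x2 = true := by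
    by_contra h
    have := I x1 x2 (by rw [s1]; exact fun e => h e.symm)
    tauto
  rcases covCore side (F 0) (F 1) (F 2) I (S 0) (S 1) (S 2) (N 0) (N 1) (N 2) x1 x2 s1 s2 f12 g12 h12
    with ⟨v, w, H⟩ | ⟨v, w, H⟩ | ⟨v, w, H⟩
  · exact hno (mk (0, v) (1, w) (1, w) fun u => by have := H u; tauto)
  · exact hno (mk (0, v) (2, w) (2, w) fun u => by have := H u; tauto)
  · exact hno (mk (1, v) (2, w) (2, w) fun u => by have := H u; tauto)
end
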